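/- arXiv:1709.00633 — 7 statements merged into one kernel-verified Lean document; each statement's English description precedes it below -/
import Mathlib

section
/- Let E be a real normed space, and let S and U be complementary subspaces of E (i.e. S ∩ U = {0} and S + U = E). Let (F_n)_{n ≥ 1} be real normed spaces and T_n : E → F_n linear maps. Let c > 0 and λ ∈ (0,1), and assume: (a) for every v ∈ S and every n ≥ 1, ‖T_n v‖ ≤ c·λ^n·‖v‖; (b) for every v ∈ U and every n ≥ 1, ‖T_n v‖ ≥ c⁻¹·λ⁻ⁿ·‖v‖. Then S = {v ∈ E : there exists B ≥ 0 such that ‖T_n v‖ ≤ B for all n ≥ 1}, i.e. the stable subspace is exactly the set of vectors whose forward images have bounded norms. -/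
/-- A nonnegative real whose products with the powers of some `r > 1` stay bounded is zero. -/
theorem eq_zero_of_forall_mul_pow_le {a r C : ℝ} (ha : 0 ≤ a) (hr : 1 < r)
    (h : ∀ n : ℕ, 1 ≤ n → a * r ^ n ≤ C) : a = 0 := by
  by_contra hne
  have hpos : 0 < a := lt_of_le_of_ne ha (Ne.symm hne)
  have htend : Filter.Tendsto (fun n : ℕ => a * r ^ n) Filter.atTop Filter.atTop :=
    (tendsto_pow_atTop_atTop_of_one_lt hr).const_mul_atTop hpos
  obtain ⟨n, hn, hn1⟩ :=
    ((htend.eventually_gt_atTop C).and (Filter.eventually_ge_atTop 1)).exists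
  exact absurd (h n hn1) (not_le.mpr hn)

/-- Lemma 3.1(i) of the paper (linear-algebraic content): the stable subspace is exactly
the set of vectors whose forward images have bounded norms. -/
theorem stable_subspace_eq_bounded_orbit
    {E : Type*} [NormedAddCommGroup E] [NormedSpace ℝ E]
    (S U : Submodule ℝ E) (hdisj : S ⊓ U = ⊥) (hspan : S ⊔ U = ⊤)
    (F : ℕ → Type*) [∀ n, NormedAddCommGroup (F n)] [∀ n, NormedSpace ℝ (F n)]
    (T : ∀ n, E →ₗ[ℝ] F n)
    (c lam : ℝ) (hc : 0 < c) (hlam : lam ∈ Set.Ioo (0 : ℝ) 1)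
    (ha : ∀ v ∈ S, ∀ n : ℕ, 1 ≤ n → ‖T n v‖ ≤ c * lam ^ n * ‖v‖)
    (hb : ∀ v ∈ U, ∀ n : ℕ, 1 ≤ n → ‖T n v‖ ≥ c⁻¹ * lam⁻¹ ^ n * ‖v‖) :
    (S : Set E) = {v : E | ∃ B : ℝ, 0 ≤ B ∧ ∀ n : ℕ, 1 ≤ n → ‖T n v‖ ≤ B} := by
  obtain ⟨hlam0, hlam1⟩ := hlam
  have hS : ∀ v ∈ S, ∀ n : ℕ, 1 ≤ n → ‖T n v‖ ≤ c * ‖v‖ := fun v hv n hn =>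
    (ha v hv n hn).trans <| by
      gcongr
      exact mul_le_of_le_one_right hc.le (pow_le_one₀ hlam0.le hlam1.le)
  ext v
  refine ⟨fun hv => ⟨c * ‖v‖, by positivity, hS v hv⟩, ?_⟩
  rintro ⟨B, -, hB⟩
  obtain ⟨s, hs, u, hu, rfl⟩ := Submodule.mem_sup.mp (hspan ▸ Submodule.mem_top : v ∈ S ⊔ U)
  have hbound : ∀ n : ℕ, 1 ≤ n → c⁻¹ * ‖u‖ * lam⁻¹ ^ n ≤ B + c * ‖s‖ := fun n hn =>
    calc c⁻¹ * ‖u‖ * lam⁻¹ ^ n = c⁻¹ * lam⁻¹ ^ n * ‖u‖ := by ring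
      _ ≤ ‖T n u‖ := hb u hu n hn
      _ = ‖T n (s + u) - T n s‖ := by rw [map_add, add_sub_cancel_left]
      _ ≤ ‖T n (s + u)‖ + ‖T n s‖ := norm_sub_le _ _
      _ ≤ B + c * ‖s‖ := add_le_add (hB n hn) (hS s hs n hn)
  have hzero : c⁻¹ * ‖u‖ = 0 :=
    eq_zero_of_forall_mul_pow_le (by positivity) ((one_lt_inv₀ hlam0).mpr hlam1) hbound
  have hu0 : u = 0 := by simpa [hc.ne'] using hzero
  simpa [hu0] using hs
end

section
/- Let E be a real normed space, S and U subspaces of E, and T : E → E a linear map with T(S) ⊆ S and T(U) ⊆ U. Let λ ∈ (0,1) and assume ‖T v‖ ≤ λ‖v‖ for all v ∈ S and ‖T v‖ ≥ λ⁻¹‖v‖ for all v ∈ U. Let α ∈ (0, (1−λ)/(1+λ)) and set λ' = λ(1+α)/(1−α) (so λ' < 1). Then for all v_s ∈ S and v_u ∈ U with ‖v_s‖ ≤ α‖v_u‖: (i) ‖T v_s‖ ≤ α‖T v_u‖, so T maps the unstable α-cone into itself; and (ii) ‖T(v_s + v_u)‖ ≥ (1/λ')·‖v_s + v_u‖. 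-/
/-- Lemma 3.3(i): the derivative maps the unstable α-cone into itself and expands
its vectors by the factor 1/λ' = (1-α)/(λ(1+α)). -/
theorem unstable_cone_invariance
    {E : Type*} [NormedAddCommGroup E] [NormedSpace ℝ E]
    (S U : Submodule ℝ E) (T : E →ₗ[ℝ] E)
    (hTS : ∀ v ∈ S, T v ∈ S) (hTU : ∀ v ∈ U, T v ∈ U)
    (lam : ℝ) (hlam : lam ∈ Set.Ioo (0 : ℝ) 1)
    (hcon : ∀ v ∈ S, ‖T v‖ ≤ lam * ‖v‖)
    (hexp : ∀ v ∈ U, ‖T v‖ ≥ lam⁻¹ * ‖v‖)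
    (α : ℝ) (hα : α ∈ Set.Ioo 0 ((1 - lam) / (1 + lam)))
    (lam' : ℝ) (hlam' : lam' = lam * (1 + α) / (1 - α)) :
    lam' < 1 ∧
    ∀ vs ∈ S, ∀ vu ∈ U, ‖vs‖ ≤ α * ‖vu‖ →
      ‖T vs‖ ≤ α * ‖T vu‖ ∧ ‖T (vs + vu)‖ ≥ (1 / lam') * ‖vs + vu‖ := by
  obtain ⟨hl0, hl1⟩ := hlam
  obtain ⟨hα0, hα⟩ := hα
  rw [lt_div_iff₀ (by linarith)] at hα
  have hα1 : 0 < 1 - α := by nlinarith [mul_pos hα0 hl0]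
  have hl' : lam * (1 + α) < 1 - α := by linarith
  subst hlam'
  refine ⟨(div_lt_one hα1).2 hl', fun vs hvs vu hvu hcone => ?_⟩
  have hu : ‖vu‖ ≤ lam * ‖T vu‖ := (inv_mul_le_iff₀ hl0).1 (hexp vu hvu)
  have hu' : ‖vu‖ ≤ ‖T vu‖ :=
    hu.trans (mul_le_of_le_one_left (norm_nonneg _) hl1.le)
  have hs : ‖T vs‖ ≤ α * ‖T vu‖ :=
    calc ‖T vs‖ ≤ lam * ‖vs‖ := hcon vs hvs
      _ ≤ ‖vs‖ := mul_le_of_le_one_left (norm_nonneg _) hl1.le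
      _ ≤ α * ‖vu‖ := hcone
      _ ≤ α * ‖T vu‖ := by gcongr
  refine ⟨hs, ?_⟩
  have hlower : (1 - α) * ‖T vu‖ ≤ ‖T (vs + vu)‖ := by
    have := norm_sub_le (T vs + T vu) (T vs)
    rw [add_sub_cancel_left, ← map_add] at this
    linarith
  have hupper : ‖vs + vu‖ ≤ lam * (1 + α) * ‖T vu‖ :=
    calc ‖vs + vu‖ ≤ ‖vs‖ + ‖vu‖ := norm_add_le _ _
      _ ≤ (1 + α) * ‖vu‖ := by linarith
      _ ≤ (1 + α) * (lam * ‖T vu‖) := by gcongr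
      _ = lam * (1 + α) * ‖T vu‖ := by ring
  have hpos : 0 < lam * (1 + α) := by positivity
  calc 1 / (lam * (1 + α) / (1 - α)) * ‖vs + vu‖
      ≤ 1 / (lam * (1 + α) / (1 - α)) * (lam * (1 + α) * ‖T vu‖) := by gcongr
    _ = (1 - α) * ‖T vu‖ := by field_simp
    _ ≤ ‖T (vs + vu)‖ := hlower
end

section
/- Let E be a real normed space, S and U subspaces of E, and T : E → E a bijective linear map with T(S) = S and T(U) = U. Let λ ∈ (0,1) and assume ‖T v‖ ≤ λ‖v‖ for all v ∈ S and ‖T v‖ ≥ λ⁻¹‖v‖ for all v ∈ U. Let α ∈ (0, (1−λ)/(1+λ)) and set λ' = λ(1+α)/(1−α) (so λ' < 1). Then for all v_s ∈ S and v_u ∈ U with ‖v_u‖ ≤ α‖v_s‖: (i) ‖T⁻¹ v_u‖ ≤ α‖T⁻¹ v_s‖, so T⁻¹ maps the stable α-cone into itself; and (ii) ‖T⁻¹(v_s + v_u)‖ ≥ (1/λ')·‖v_s + v_u‖. -/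
theorem LinearEquiv.symm_apply_mem_of_map_eq {R M : Type*} [Semiring R] [AddCommMonoid M]
    [Module R M] {p : Submodule R M} (e : M ≃ₗ[R] M) (h : p.map (e : M →ₗ[R] M) = p)
    {x : M} (hx : x ∈ p) : e.symm x ∈ p := by
  rw [← h] at hx
  obtain ⟨y, hy, rfl⟩ := hx
  simpa using hy

/-- Lemma 3.3(ii): the inverse of the derivative maps the stable α-cone into itself
and expands its vectors by the factor 1/λ' = (1-α)/(λ(1+α)). -/
theorem stable_cone_invariance_inverse
    {E : Type*} [NormedAddCommGroup E] [NormedSpace ℝ E]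
    (S U : Submodule ℝ E) (T : E ≃ₗ[ℝ] E)
    (hTS : S.map (T : E →ₗ[ℝ] E) = S) (hTU : U.map (T : E →ₗ[ℝ] E) = U)
    (lam : ℝ) (hlam : lam ∈ Set.Ioo (0 : ℝ) 1)
    (hcon : ∀ v ∈ S, ‖T v‖ ≤ lam * ‖v‖)
    (hexp : ∀ v ∈ U, ‖T v‖ ≥ lam⁻¹ * ‖v‖)
    (α : ℝ) (hα : α ∈ Set.Ioo 0 ((1 - lam) / (1 + lam)))
    (lam' : ℝ) (hlam' : lam' = lam * (1 + α) / (1 - α)) :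
    lam' < 1 ∧
    ∀ vs ∈ S, ∀ vu ∈ U, ‖vu‖ ≤ α * ‖vs‖ →
      ‖T.symm vu‖ ≤ α * ‖T.symm vs‖ ∧
      ‖T.symm (vs + vu)‖ ≥ (1 / lam') * ‖vs + vu‖ := by
  obtain ⟨hl0, hl1⟩ := hlam
  obtain ⟨hα0, hα1⟩ := hα
  rw [lt_div_iff₀ (by linarith)] at hα1
  have hαl : 0 < α * lam := mul_pos hα0 hl0
  have hα : 0 < 1 - α := by linarith
  subst hlam'
  refine ⟨by rw [div_lt_one hα]; linarith, fun vs hvs vu hvu hcone => ?_⟩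
  have hs : ‖vs‖ ≤ lam * ‖T.symm vs‖ := by
    simpa using hcon _ (T.symm_apply_mem_of_map_eq hTS hvs)
  have hu : ‖T.symm vu‖ ≤ lam * ‖vu‖ := by
    have h := hexp _ (T.symm_apply_mem_of_map_eq hTU hvu)
    rwa [LinearEquiv.apply_symm_apply, ge_iff_le, inv_mul_le_iff₀ hl0] at h
  have hinv : ‖T.symm vu‖ ≤ α * ‖T.symm vs‖ :=
    calc ‖T.symm vu‖ ≤ lam * ‖vu‖ := hu
      _ ≤ ‖vu‖ := mul_le_of_le_one_left (norm_nonneg _) hl1.le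
      _ ≤ α * ‖vs‖ := hcone
      _ ≤ α * ‖T.symm vs‖ := by
        gcongr
        exact hs.trans (mul_le_of_le_one_left (norm_nonneg _) hl1.le)
  refine ⟨hinv, ?_⟩
  have hlower : (1 - α) * ‖T.symm vs‖ ≤ ‖T.symm (vs + vu)‖ := by
    rw [map_add]
    linarith [norm_sub_le_norm_add (T.symm vs) (T.symm vu)]
  have hupper : ‖vs + vu‖ ≤ (1 + α) * (lam * ‖T.symm vs‖) :=
    calc ‖vs + vu‖ ≤ (1 + α) * ‖vs‖ := by linarith [norm_add_le vs vu]
      _ ≤ (1 + α) * (lam * ‖T.symm vs‖) := by gcongr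
  have hpos : 0 < lam * (1 + α) := by positivity
  rw [ge_iff_le, one_div_div, div_mul_eq_mul_div, div_le_iff₀ hpos]
  calc (1 - α) * ‖vs + vu‖ ≤ (1 - α) * ((1 + α) * (lam * ‖T.symm vs‖)) := by gcongr
    _ = (1 - α) * ‖T.symm vs‖ * (lam * (1 + α)) := by ring
    _ ≤ ‖T.symm (vs + vu)‖ * (lam * (1 + α)) := by gcongr
end

section
/- Let (E_n)_{n ∈ ℕ} be real normed spaces and A_n : E_n → E_{n+1} linear maps; for i, n ∈ ℕ let C_{i,n} : E_i → E_{i+n} denote the composite A_{i+n−1} ∘ ⋯ ∘ A_i, with C_{i,0} the identity of E_i. Let c > 0, λ ∈ (0,1), ε > 0 and let v ∈ E_0 satisfy ‖C_{0,n} v‖ ≤ c·λ^n·‖v‖ for all n ∈ ℕ. Define N_i(w) = Σ_{n=0}^∞ (λ+ε)^{−n}·‖C_{i,n} w‖ whenever this series converges. Then both N_0(v) and N_1(A_0 v) are given by convergent series, and N_1(A_0 v) = (λ+ε)·(N_0(v) − ‖v‖); in particular N_1(A_0 v) ≤ (λ+ε)·N_0(v). -/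
/-- The composite C_{i,n} = A_{i+n-1} ∘ ⋯ ∘ A_i : E i → E (i+n), with C_{i,0} = id. -/
def seqComp {E : ℕ → Type*} [∀ n, NormedAddCommGroup (E n)] [∀ n, NormedSpace ℝ (E n)]
    (A : ∀ n, E n →ₗ[ℝ] E (n + 1)) (i : ℕ) : ∀ n : ℕ, E i →ₗ[ℝ] E (i + n)
  | 0 => LinearMap.id
  | n + 1 => (A (i + n)).comp (seqComp A i n)

theorem seqComp_succ_apply_heq
    {E : ℕ → Type*} [∀ n, NormedAddCommGroup (E n)] [∀ n, NormedSpace ℝ (E n)]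
    (A : ∀ n, E n →ₗ[ℝ] E (n + 1)) (i : ℕ) (w : E i) (n : ℕ) :
    HEq (seqComp A (i + 1) n (A i w)) (seqComp A i (n + 1) w) := by
  induction n with
  | zero => exact HEq.rfl
  | succ n ih =>
    have apply_congr : ∀ {j k : ℕ} (_ : j = k) {x : E j} {y : E k},
        HEq x y → HEq (A j x) (A k y) := by
      rintro j _ rfl x y h
      rw [eq_of_heq h]
    exact apply_congr (by omega) ih

theorem norm_seqComp_succ_apply
    {E : ℕ → Type*} [∀ n, NormedAddCommGroup (E n)] [∀ n, NormedSpace ℝ (E n)]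
    (A : ∀ n, E n →ₗ[ℝ] E (n + 1)) (i : ℕ) (w : E i) (n : ℕ) :
    ‖seqComp A (i + 1) n (A i w)‖ = ‖seqComp A i (n + 1) w‖ := by
  have norm_congr : ∀ {j k : ℕ} (_ : j = k) {x : E j} {y : E k}, HEq x y → ‖x‖ = ‖y‖ := by
    rintro j _ rfl x y h
    rw [eq_of_heq h]
  exact norm_congr (by omega) (seqComp_succ_apply_heq A i w n)

/-- One-step contraction property of the adapted (Mather) norm in Proposition 3.7:
N₁(A₀ v) = (λ+ε)(N₀(v) - ‖v‖); in particular N₁(A₀ v) ≤ (λ+ε) N₀(v). -/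
theorem adapted_norm_one_step_contraction
    {E : ℕ → Type*} [∀ n, NormedAddCommGroup (E n)] [∀ n, NormedSpace ℝ (E n)]
    (A : ∀ n, E n →ₗ[ℝ] E (n + 1))
    (c lam ε : ℝ) (hc : 0 < c) (hlam : lam ∈ Set.Ioo (0 : ℝ) 1) (hε : 0 < ε)
    (v : E 0) (hv : ∀ n : ℕ, ‖seqComp A 0 n v‖ ≤ c * lam ^ n * ‖v‖) :
    Summable (fun n : ℕ => (lam + ε)⁻¹ ^ n * ‖seqComp A 0 n v‖) ∧
    Summable (fun n : ℕ => (lam + ε)⁻¹ ^ n * ‖seqComp A 1 n (A 0 v)‖) ∧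
    (∑' n : ℕ, (lam + ε)⁻¹ ^ n * ‖seqComp A 1 n (A 0 v)‖)
      = (lam + ε) * ((∑' n : ℕ, (lam + ε)⁻¹ ^ n * ‖seqComp A 0 n v‖) - ‖v‖) ∧
    (∑' n : ℕ, (lam + ε)⁻¹ ^ n * ‖seqComp A 1 n (A 0 v)‖)
      ≤ (lam + ε) * (∑' n : ℕ, (lam + ε)⁻¹ ^ n * ‖seqComp A 0 n v‖) := by
  obtain ⟨hl0, -⟩ := hlam
  have hpos : 0 < lam + ε := by linarith
  have hsum : Summable (fun n : ℕ => (lam + ε)⁻¹ ^ n * ‖seqComp A 0 n v‖) := by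
    have hgeom : Summable (fun n : ℕ => (c * ‖v‖) * ((lam + ε)⁻¹ * lam) ^ n) := by
      refine (summable_geometric_of_lt_one (by positivity) ?_).mul_left _
      rw [inv_mul_lt_iff₀ hpos]
      linarith
    refine Summable.of_nonneg_of_le (fun n => by positivity) (fun n => ?_) hgeom
    calc (lam + ε)⁻¹ ^ n * ‖seqComp A 0 n v‖
        ≤ (lam + ε)⁻¹ ^ n * (c * lam ^ n * ‖v‖) := by gcongr; exact hv n
      _ = (c * ‖v‖) * ((lam + ε)⁻¹ * lam) ^ n := by rw [mul_pow]; ring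
  have hshift : (fun n : ℕ => (lam + ε)⁻¹ ^ n * ‖seqComp A 1 n (A 0 v)‖)
      = fun n => (lam + ε) * ((lam + ε)⁻¹ ^ (n + 1) * ‖seqComp A 0 (n + 1) v‖) := by
    funext n
    have hn : ‖seqComp A 1 n (A 0 v)‖ = ‖seqComp A 0 (n + 1) v‖ :=
      norm_seqComp_succ_apply A 0 v n
    rw [hn, pow_succ]
    field_simp
  have heq : (∑' n : ℕ, (lam + ε)⁻¹ ^ n * ‖seqComp A 1 n (A 0 v)‖)
      = (lam + ε) * ((∑' n : ℕ, (lam + ε)⁻¹ ^ n * ‖seqComp A 0 n v‖) - ‖v‖) := by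
    have h0 : ‖seqComp A 0 0 v‖ = ‖v‖ := rfl
    rw [hshift, tsum_mul_left, hsum.tsum_eq_zero_add, pow_zero, one_mul, h0, add_sub_cancel_left]
  refine ⟨hsum, ?_, heq, ?_⟩
  · rw [hshift]
    exact ((summable_nat_add_iff 1).2 hsum).mul_left _
  · rw [heq]
    gcongr
    exact sub_le_self _ (norm_nonneg v)
end

section
/- Let G and G' be real normed spaces and A : G → G' a linear bijection. Let (H_n)_{n ∈ ℕ} be real normed spaces with H_0 = G, and D_n : G → H_n linear maps with D_0 = id_G. Let c > 0, λ ∈ (0,1), ε > 0, and let v ∈ G satisfy ‖D_n v‖ ≤ c·λ^n·‖v‖ for all n. Define D'_0 = id_{G'} and D'_{n+1} = D_n ∘ A⁻¹ : G' → H_n for n ∈ ℕ, and set N(v) = Σ_{n=0}^∞ (λ+ε)^{−n}‖D_n v‖ and N'(w) = Σ_{n=0}^∞ (λ+ε)^{−n}‖D'_n w‖. Then both series converge at v and at A v respectively, and N'(A v) = ‖A v‖ + (λ+ε)^{−1}·N(v); in particular N'(A v) ≥ (λ+ε)^{−1}·N(v), i.e. N(A⁻¹ w) ≤ (λ+ε)·N'(w)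 for w = A v. -/
/-- The sequence n ↦ (λ+ε)^{-n} ‖D'_n w‖, where D'_0 = id_{G'} and D'_{n+1} = D_n ∘ A⁻¹. -/
noncomputable def primedSeq {G G' : Type*} [NormedAddCommGroup G] [NormedSpace ℝ G]
    [NormedAddCommGroup G'] [NormedSpace ℝ G']
    {H : ℕ → Type*} [∀ n, NormedAddCommGroup (H n)] [∀ n, NormedSpace ℝ (H n)]
    (A : G ≃ₗ[ℝ] G') (D : ∀ n, G →ₗ[ℝ] H n) (lam ε : ℝ) (w : G') : ℕ → ℝ
  | 0 => ‖w‖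
  | n + 1 => (lam + ε)⁻¹ ^ (n + 1) * ‖D n (A.symm w)‖

theorem summable_inv_pow_mul_of_le_geometric {c lam mu : ℝ} (hlam : 0 ≤ lam) (h : lam < mu)
    {a : ℕ → ℝ} (ha : ∀ n, 0 ≤ a n) (hle : ∀ n, a n ≤ c * lam ^ n) :
    Summable fun n => mu⁻¹ ^ n * a n := by
  have hmu : 0 < mu := hlam.trans_lt h
  have hgeom : Summable fun n : ℕ => c * (lam / mu) ^ n :=
    (summable_geometric_of_lt_one (by positivity) ((div_lt_one hmu).2 h)).mul_left c
  refine hgeom.of_nonneg_of_le (fun n => mul_nonneg (by positivity) (ha n)) fun n => ?_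
  calc mu⁻¹ ^ n * a n ≤ mu⁻¹ ^ n * (c * lam ^ n) := by gcongr; exact hle n
    _ = c * (lam / mu) ^ n := by rw [div_eq_mul_inv, mul_pow]; ring

/-- One-step expansion property of the adapted (Mather) norm on the unstable subbundle
(Proposition 3.7): N'(A v) = ‖A v‖ + (λ+ε)⁻¹ N(v); in particular
N'(A v) ≥ (λ+ε)⁻¹ N(v), i.e. N(A⁻¹ w) ≤ (λ+ε) N'(w) for w = A v.  (Here `H 0 = G` and
`D 0 = id` are encoded by the hypothesis `hD0` that `D 0` preserves norms.) -/
theorem adapted_norm_one_step_expansion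
    {G G' : Type*} [NormedAddCommGroup G] [NormedSpace ℝ G]
    [NormedAddCommGroup G'] [NormedSpace ℝ G']
    (A : G ≃ₗ[ℝ] G')
    (H : ℕ → Type*) [∀ n, NormedAddCommGroup (H n)] [∀ n, NormedSpace ℝ (H n)]
    (D : ∀ n, G →ₗ[ℝ] H n)
    (hD0 : ∀ x : G, ‖D 0 x‖ = ‖x‖)
    (c lam ε : ℝ) (hc : 0 < c) (hlam : lam ∈ Set.Ioo (0 : ℝ) 1) (hε : 0 < ε)
    (v : G) (hv : ∀ n : ℕ, ‖D n v‖ ≤ c * lam ^ n * ‖v‖) :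
    Summable (fun n : ℕ => (lam + ε)⁻¹ ^ n * ‖D n v‖) ∧
    Summable (primedSeq A D lam ε (A v)) ∧
    (∑' n : ℕ, primedSeq A D lam ε (A v) n)
      = ‖A v‖ + (lam + ε)⁻¹ * (∑' n : ℕ, (lam + ε)⁻¹ ^ n * ‖D n v‖) ∧
    (lam + ε)⁻¹ * (∑' n : ℕ, (lam + ε)⁻¹ ^ n * ‖D n v‖)
      ≤ (∑' n : ℕ, primedSeq A D lam ε (A v) n) ∧
    (∑' n : ℕ, (lam + ε)⁻¹ ^ n * ‖D n (A.symm (A v))‖)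
      ≤ (lam + ε) * (∑' n : ℕ, primedSeq A D lam ε (A v) n) := by
  have hpos : 0 < lam + ε := add_pos hlam.1 hε
  have hN : Summable (fun n : ℕ => (lam + ε)⁻¹ ^ n * ‖D n v‖) :=
    summable_inv_pow_mul_of_le_geometric (c := c * ‖v‖) hlam.1.le (lt_add_of_pos_right lam hε)
      (fun n => norm_nonneg _) fun n => (hv n).trans_eq (by ring)
  have hshift : (fun n => primedSeq A D lam ε (A v) (n + 1))
      = fun n : ℕ => (lam + ε)⁻¹ * ((lam + ε)⁻¹ ^ n * ‖D n v‖) := by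
    funext n
    simp only [primedSeq, LinearEquiv.symm_apply_apply]
    ring
  have hN' : Summable (primedSeq A D lam ε (A v)) := by
    rw [← summable_nat_add_iff 1, hshift]
    exact hN.mul_left _
  have heq : (∑' n : ℕ, primedSeq A D lam ε (A v) n)
      = ‖A v‖ + (lam + ε)⁻¹ * (∑' n : ℕ, (lam + ε)⁻¹ ^ n * ‖D n v‖) := by
    rw [hN'.tsum_eq_zero_add, hshift, tsum_mul_left]
    rfl
  have hle : (lam + ε)⁻¹ * (∑' n : ℕ, (lam + ε)⁻¹ ^ n * ‖D n v‖)
      ≤ (∑' n : ℕ, primedSeq A D lam ε (A v) n) :=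
    heq ▸ le_add_of_nonneg_left (norm_nonneg _)
  refine ⟨hN, hN', heq, hle, ?_⟩
  simp only [LinearEquiv.symm_apply_apply]
  exact (inv_mul_le_iff₀ hpos).1 hle
end

section
/- Let X and Y be real normed spaces and equip X × Y with the sup norm ‖(x,y)‖ = max(‖x‖,‖y‖). Let λ ∈ (0,1), α ∈ (0,1), and σ ≥ 0 with σ < α(λ⁻¹ − λ)/(2(1+α)²). Let T₁ : X → X and T₂ : Y → Y be linear maps with ‖T₁ x‖ ≤ λ‖x‖ for all x ∈ X and ‖T₂ y‖ ≥ λ⁻¹‖y‖ for all y ∈ Y. Let L : X × Y → X × Y be a linear map such that for all (x,y) ∈ X × Y, ‖(L(x,y)).1 − T₁ x‖ ≤ 2σ(‖x‖ + ‖y‖) and ‖(L(x,y)).2 − T₂ y‖ ≤ 2σ(‖x‖ + ‖y‖). Then for every (x,y) with ‖x‖ ≤ α‖y‖ and y ≠ 0, one has ‖(L(x,y)).1‖ < α·‖(L(x,y)).2‖; i.e. L maps the closed unstable α-cone {(x,y) : ‖x‖ ≤ α‖y‖} into the open unstable α-cone. -/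
/-- Abstract core of Lemma 4.3(i): a small perturbation L of the block-diagonal hyperbolic
map T₁ ⊕ T₂ maps the closed unstable α-cone into the open unstable α-cone.
(The product X × Y carries the sup norm ‖(x,y)‖ = max(‖x‖,‖y‖), which is the norm of
the Mathlib product instance.) -/
theorem perturbed_unstable_cone_invariance
    {X Y : Type*} [NormedAddCommGroup X] [NormedSpace ℝ X]
    [NormedAddCommGroup Y] [NormedSpace ℝ Y]
    (lam α σ : ℝ) (hlam : lam ∈ Set.Ioo (0 : ℝ) 1) (hα : α ∈ Set.Ioo (0 : ℝ) 1)
    (hσ0 : 0 ≤ σ) (hσ : σ < α * (lam⁻¹ - lam) / (2 * (1 + α) ^ 2))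
    (T₁ : X →ₗ[ℝ] X) (T₂ : Y →ₗ[ℝ] Y)
    (hT₁ : ∀ x : X, ‖T₁ x‖ ≤ lam * ‖x‖)
    (hT₂ : ∀ y : Y, ‖T₂ y‖ ≥ lam⁻¹ * ‖y‖)
    (L : X × Y →ₗ[ℝ] X × Y)
    (hL1 : ∀ x : X, ∀ y : Y, ‖(L (x, y)).1 - T₁ x‖ ≤ 2 * σ * (‖x‖ + ‖y‖))
    (hL2 : ∀ x : X, ∀ y : Y, ‖(L (x, y)).2 - T₂ y‖ ≤ 2 * σ * (‖x‖ + ‖y‖)) :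
    ∀ x : X, ∀ y : Y, ‖x‖ ≤ α * ‖y‖ → y ≠ 0 →
      ‖(L (x, y)).1‖ < α * ‖(L (x, y)).2‖ := by
  intro x y hxy hy
  have hy0 : 0 < ‖y‖ := norm_pos_iff.mpr hy
  have hα0 : 0 < α := hα.1
  have hsmall : σ * (2 * (1 + α) ^ 2) < α * (lam⁻¹ - lam) :=
    (lt_div_iff₀ (by positivity)).mp hσ
  have herr : 2 * σ * (‖x‖ + ‖y‖) ≤ 2 * σ * ((1 + α) * ‖y‖) :=
    mul_le_mul_of_nonneg_left (by linarith) (by positivity)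
  have hT₁x : ‖T₁ x‖ ≤ lam * (α * ‖y‖) :=
    (hT₁ x).trans (mul_le_mul_of_nonneg_left hxy hlam.1.le)
  have hfst : ‖(L (x, y)).1‖ ≤ lam * (α * ‖y‖) + 2 * σ * ((1 + α) * ‖y‖) := by
    linarith [norm_sub_norm_le (L (x, y)).1 (T₁ x), hL1 x y]
  have hsnd : lam⁻¹ * ‖y‖ - 2 * σ * ((1 + α) * ‖y‖) ≤ ‖(L (x, y)).2‖ := by
    linarith [norm_sub_norm_le (T₂ y) (L (x, y)).2, norm_sub_rev (T₂ y) (L (x, y)).2,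
      hL2 x y, hT₂ y]
  calc ‖(L (x, y)).1‖
      ≤ lam * (α * ‖y‖) + 2 * σ * ((1 + α) * ‖y‖) := hfst
    _ < α * (lam⁻¹ * ‖y‖ - 2 * σ * ((1 + α) * ‖y‖)) := by
      linarith [mul_lt_mul_of_pos_right hsmall hy0]
    _ ≤ α * ‖(L (x, y)).2‖ := mul_le_mul_of_nonneg_left hsnd hα0.le
end

section
/- Let X and Y be real normed spaces and equip X × Y with the sup norm ‖(x,y)‖ = max(‖x‖,‖y‖). Let λ ∈ (0,1), α ∈ (0,1), and σ ≥ 0 with σ < (λ⁻¹ − 1)/(2(1+α)), and set η⁻¹ := λ⁻¹ − 2σ(1+α), so that η⁻¹ > 1. Let T₁ : X → X and T₂ : Y → Y be linear maps with ‖T₁ x‖ ≤ λ‖x‖ for all x ∈ X and ‖T₂ y‖ ≥ λ⁻¹‖y‖ for all y ∈ Y, and let L : X × Y → X × Y be a linear map such that for all (x,y), ‖(L(x,y)).1 − T₁ x‖ ≤ 2σ(‖x‖+‖y‖) and ‖(L(x,y)).2 − T₂ y‖ ≤ 2σ(‖x‖+‖y‖). Then for every (x,y) with ‖x‖ ≤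 α‖y‖, one has ‖L(x,y)‖ ≥ η⁻¹·‖(x,y)‖. -/
/-- Abstract core of Lemma 4.4(i): a small perturbation L of the block-diagonal hyperbolic
map T₁ ⊕ T₂ expands every vector of the closed unstable α-cone by the factor
η⁻¹ = λ⁻¹ - 2σ(1+α) > 1.  (The product X × Y carries the sup norm
‖(x,y)‖ = max(‖x‖,‖y‖), which is the norm of the Mathlib product instance.) -/
theorem perturbed_unstable_cone_expansion
    {X Y : Type*} [NormedAddCommGroup X] [NormedSpace ℝ X]
    [NormedAddCommGroup Y] [NormedSpace ℝ Y]
    (lam α σ : ℝ) (hlam : lam ∈ Set.Ioo (0 : ℝ) 1) (hα : α ∈ Set.Ioo (0 : ℝ) 1)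
    (hσ0 : 0 ≤ σ) (hσ : σ < (lam⁻¹ - 1) / (2 * (1 + α)))
    (T₁ : X →ₗ[ℝ] X) (T₂ : Y →ₗ[ℝ] Y)
    (hT₁ : ∀ x : X, ‖T₁ x‖ ≤ lam * ‖x‖)
    (hT₂ : ∀ y : Y, ‖T₂ y‖ ≥ lam⁻¹ * ‖y‖)
    (L : X × Y →ₗ[ℝ] X × Y)
    (hL1 : ∀ x : X, ∀ y : Y, ‖(L (x, y)).1 - T₁ x‖ ≤ 2 * σ * (‖x‖ + ‖y‖))
    (hL2 : ∀ x : X, ∀ y : Y, ‖(L (x, y)).2 - T₂ y‖ ≤ 2 * σ * (‖x‖ + ‖y‖)) :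
    1 < lam⁻¹ - 2 * σ * (1 + α) ∧
    ∀ x : X, ∀ y : Y, ‖x‖ ≤ α * ‖y‖ →
      ‖L (x, y)‖ ≥ (lam⁻¹ - 2 * σ * (1 + α)) * ‖(x, y)‖ := by
  obtain ⟨hα0, hα1⟩ := hα
  refine ⟨?_, fun x y hxy => ?_⟩
  · rw [lt_div_iff₀ (by linarith)] at hσ
    linarith
  · have hmax : ‖(x, y)‖ = ‖y‖ := by
      rw [Prod.norm_mk]
      exact max_eq_right (hxy.trans (mul_le_of_le_one_left (norm_nonneg y) hα1.le))
    have hsnd : ‖(L (x, y)).2‖ ≤ ‖L (x, y)‖ := norm_snd_le _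
    have htri : ‖T₂ y‖ - ‖(L (x, y)).2‖ ≤ ‖(L (x, y)).2 - T₂ y‖ := by
      rw [norm_sub_rev]
      exact norm_sub_norm_le _ _
    have hcone : 2 * σ * (‖x‖ + ‖y‖) ≤ 2 * σ * (α * ‖y‖ + ‖y‖) := by gcongr
    rw [hmax]
    linarith [hL2 x y, hT₂ y]
end
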